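/- arXiv:1711.07413 — 2 statements merged into one kernel-verified Lean document; each statement's English description precedes it below -/
import Mathlib

section
/- Let n ≥ 1, let p′ ∈ (1, ∞), and let C, D ≥ 0. Let (f_m)_{m ∈ ℕ} be a sequence of measurable functions ℝ^n → ℝ such that |f_m(x)| ≤ C for almost every x and every m, and f_m(x) → 0 as m → ∞ for almost every x. Let K be a set of measurable functions g : ℝ^n → ℂ such that (i) for all g ∈ K, (∫_{ℝ^n} |g|^{2p′} dx)^{1/(2p′)} ≤ D, and (ii) sup_{g ∈ K} ∫_{|x| > R} |g(x)|² dx → 0 as R → ∞. Then sup_{g ∈ K} (∫_{ℝ^n} |f_m(x)|² |g(x)|² dx)^{1/2} → 0 as m → ∞. -/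
open MeasureTheory

open scoped ENNReal

/-- Bounded convergence for powers of `ℝ≥0∞`-valued functions on a finite measure space. -/
lemma tendsto_lintegral_rpow_zero_of_bounded {α : Type*} [MeasurableSpace α] {μ : Measure α}
    [IsFiniteMeasure μ] {F : ℕ → α → ℝ≥0∞} (hF : ∀ m, Measurable (F m)) {c : ℝ≥0∞}
    (hc : c ≠ ∞) (hFc : ∀ m, ∀ᵐ x ∂μ, F m x ≤ c)
    (hF0 : ∀ᵐ x ∂μ, Filter.Tendsto (fun m => F m x) Filter.atTop (nhds 0))
    {q : ℝ} (hq : 0 < q) :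
    Filter.Tendsto (fun m => ∫⁻ x, F m x ^ q ∂μ) Filter.atTop (nhds 0) := by
  have h := tendsto_lintegral_of_dominated_convergence (μ := μ) (F := fun m x => F m x ^ q)
    (f := fun _ => 0) (fun _ => c ^ q) (fun m => (hF m).pow_const q)
    (fun m => (hFc m).mono fun x hx => ENNReal.rpow_le_rpow hx hq.le)
    (by
      rw [lintegral_const]
      exact ENNReal.mul_ne_top (ENNReal.rpow_ne_top_of_nonneg hq.le hc) (measure_ne_top _ _))
    (hF0.mono fun x hx => by
      simpa [Function.comp_def, ENNReal.zero_rpow_of_pos hq] using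
        (ENNReal.continuous_rpow_const (y := q)).tendsto 0 |>.comp hx)
  simpa using h

/-- Hölder's inequality for `∫ F |g|²`, with the `L^{2p}` norm of `g`. -/
lemma lintegral_mul_enorm_sq_le {α E : Type*} [MeasurableSpace α] {μ : Measure α}
    [NormedAddCommGroup E] {F : α → ℝ≥0∞} (hF : AEMeasurable F μ) {g : α → E}
    (hg : AEStronglyMeasurable g μ) {p q : ℝ} (hpq : p.HolderConjugate q) :
    ∫⁻ x, F x * ‖g x‖ₑ ^ 2 ∂μ ≤
      (∫⁻ x, F x ^ q ∂μ) ^ (1 / q) * eLpNorm g (ENNReal.ofReal (2 * p)) μ ^ 2 := by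
  have hp : 0 < p := hpq.pos
  have h := ENNReal.lintegral_mul_le_Lp_mul_Lq μ hpq.symm hF (hg.enorm.pow_const 2)
  have hnorm : eLpNorm g (ENNReal.ofReal (2 * p)) μ ^ 2 =
      (∫⁻ x, (‖g x‖ₑ ^ 2) ^ p ∂μ) ^ (1 / p) := by
    rw [eLpNorm_eq_lintegral_rpow_enorm_toReal (by simpa using hp) ENNReal.ofReal_ne_top,
      ENNReal.toReal_ofReal (by positivity), ← ENNReal.rpow_natCast, ← ENNReal.rpow_mul]
    congr 1
    · refine lintegral_congr fun x => ?_
      rw [← ENNReal.rpow_natCast, ← ENNReal.rpow_mul]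
      norm_num
    · push_cast
      field_simp
  rw [hnorm]
  exact h

/-- Uniform vanishing: if `(f_m)` is uniformly essentially bounded and converges to `0`
a.e., and `K` is a family of functions with uniformly bounded `L^{2p'}` norms and
uniformly small tails, then `sup_{g ∈ K} (∫ |f_m|² |g|²)^{1/2} → 0` as `m → ∞`. -/
theorem uniform_vanishing_of_weighted_L2_norms
    {n : ℕ} (hn : 1 ≤ n) (p' : ℝ) (hp' : 1 < p')
    (C D : ℝ) (hC : 0 ≤ C) (hD : 0 ≤ D)
    (f : ℕ → EuclideanSpace ℝ (Fin n) → ℝ) (hfm : ∀ m, Measurable (f m))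
    (hfC : ∀ m, ∀ᵐ x, |f m x| ≤ C)
    (hf0 : ∀ᵐ x : EuclideanSpace ℝ (Fin n),
      Filter.Tendsto (fun m => f m x) Filter.atTop (nhds 0))
    (K : Set (EuclideanSpace ℝ (Fin n) → ℂ))
    (hKm : ∀ g ∈ K, AEStronglyMeasurable g volume)
    (hKp : ∀ g ∈ K, eLpNorm g (ENNReal.ofReal (2 * p')) volume ≤ ENNReal.ofReal D)
    (hKt : ∀ ε : ℝ, 0 < ε → ∃ R : ℝ, 0 < R ∧ ∀ g ∈ K,
      (∫⁻ x in {x : EuclideanSpace ℝ (Fin n) | R < ‖x‖}, (‖g x‖₊ : ENNReal) ^ 2)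
        ≤ ENNReal.ofReal ε) :
    ∀ ε : ℝ, 0 < ε → ∃ M : ℕ, ∀ m ≥ M, ∀ g ∈ K,
      Real.sqrt (∫ x, (f m x) ^ 2 * ‖g x‖ ^ 2) ≤ ε := by
  intro ε hε
  obtain ⟨R, -, hR⟩ := hKt (ε ^ 2 / 2 / (C ^ 2 + 1)) (by positivity)
  set S : Set (EuclideanSpace ℝ (Fin n)) := {x | R < ‖x‖} with hS
  have hSm : MeasurableSet S := measurableSet_lt measurable_const measurable_norm
  have hSc : Sᶜ = Metric.closedBall 0 R := by
    ext x
    simp [hS]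
  have : IsFiniteMeasure (volume.restrict Sᶜ) :=
    ⟨by
      rw [Measure.restrict_apply_univ, hSc]
      exact measure_closedBall_lt_top⟩
  have hpq := Real.HolderConjugate.conjExponent hp'
  set q := p'.conjExponent
  have hFm : ∀ m, Measurable fun x => ‖f m x‖ₑ ^ 2 := fun m => (hfm m).enorm.pow_const 2
  have hFC : ∀ m, ∀ᵐ x, ‖f m x‖ₑ ^ 2 ≤ ENNReal.ofReal (C ^ 2) := fun m =>
    (hfC m).mono fun x hx => by
      rw [ENNReal.ofReal_pow hC, Real.enorm_eq_ofReal_abs]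
      gcongr
  have hF0 : ∀ᵐ x, Filter.Tendsto (fun m => ‖f m x‖ₑ ^ 2) Filter.atTop (nhds 0) :=
    hf0.mono fun x hx => by
      simpa [Function.comp_def] using
        ((ENNReal.continuous_pow 2).comp continuous_enorm).tendsto 0 |>.comp hx
  have hlim : Filter.Tendsto (fun m =>
      (∫⁻ x in Sᶜ, (‖f m x‖ₑ ^ 2) ^ q) ^ (1 / q) * ENNReal.ofReal D ^ 2)
      Filter.atTop (nhds 0) := by
    have h := tendsto_lintegral_rpow_zero_of_bounded (μ := volume.restrict Sᶜ) hFm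
      ENNReal.ofReal_ne_top (fun m => ae_restrict_of_ae (hFC m)) (ae_restrict_of_ae hF0)
      hpq.symm.pos
    have hq : 0 < 1 / q := one_div_pos.2 hpq.symm.pos
    have h2 := ((ENNReal.continuous_rpow_const (y := 1 / q)).tendsto 0).comp h
    rw [ENNReal.zero_rpow_of_pos hq] at h2
    simpa using ENNReal.Tendsto.mul_const (b := ENNReal.ofReal D ^ 2) h2
      (Or.inr (ENNReal.pow_ne_top ENNReal.ofReal_ne_top))
  obtain ⟨M, hM⟩ := Filter.eventually_atTop.1 (hlim.eventually_le_const
    (show 0 < ENNReal.ofReal (ε ^ 2 / 2) from ENNReal.ofReal_pos.2 (by positivity)))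
  refine ⟨M, fun m hm g hg => ?_⟩
  have hball : ∫⁻ x in Sᶜ, ‖f m x‖ₑ ^ 2 * ‖g x‖ₑ ^ 2 ≤ ENNReal.ofReal (ε ^ 2 / 2) := by
    refine (lintegral_mul_enorm_sq_le (hFm m).aemeasurable (hKm g hg).restrict hpq).trans
      (le_trans ?_ (hM m hm))
    gcongr
    exact (eLpNorm_mono_measure g Measure.restrict_le_self).trans (hKp g hg)
  have htail : ∫⁻ x in S, ‖f m x‖ₑ ^ 2 * ‖g x‖ₑ ^ 2 ≤ ENNReal.ofReal (ε ^ 2 / 2) := by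
    calc ∫⁻ x in S, ‖f m x‖ₑ ^ 2 * ‖g x‖ₑ ^ 2
        ≤ ∫⁻ x in S, ENNReal.ofReal (C ^ 2) * ‖g x‖ₑ ^ 2 :=
          lintegral_mono_ae <| ae_restrict_of_ae <| (hFC m).mono fun x hx => by gcongr
      _ = ENNReal.ofReal (C ^ 2) * ∫⁻ x in S, ‖g x‖ₑ ^ 2 :=
          lintegral_const_mul' _ _ ENNReal.ofReal_ne_top
      _ ≤ ENNReal.ofReal (C ^ 2) * ENNReal.ofReal (ε ^ 2 / 2 / (C ^ 2 + 1)) := by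
          gcongr
          exact hR g hg
      _ ≤ ENNReal.ofReal (ε ^ 2 / 2) := by
          rw [← ENNReal.ofReal_mul (by positivity)]
          apply ENNReal.ofReal_le_ofReal
          rw [← mul_div_assoc, div_le_iff₀ (by positivity)]
          nlinarith [sq_nonneg ε]
  have htotal : ∫⁻ x, ‖f m x‖ₑ ^ 2 * ‖g x‖ₑ ^ 2 ≤ ENNReal.ofReal (ε ^ 2) := by
    rw [← lintegral_add_compl _ hSm, ← add_halves (ε ^ 2),
      ENNReal.ofReal_add (by positivity) (by positivity)]
    exact add_le_add htail hball
  refine Real.sqrt_le_iff.2 ⟨hε.le, ?_⟩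
  have hmeas : AEStronglyMeasurable (fun x => f m x ^ 2 * ‖g x‖ ^ 2) volume :=
    ((hfm m).pow_const 2).aestronglyMeasurable.mul ((hKm g hg).norm.pow 2)
  rw [integral_eq_lintegral_of_nonneg_ae (Filter.Eventually.of_forall fun x => by positivity) hmeas]
  refine ENNReal.toReal_le_of_le_ofReal (by positivity) (le_of_eq_of_le ?_ htotal)
  refine lintegral_congr fun x => ?_
  rw [ENNReal.ofReal_mul (sq_nonneg _), ← sq_abs, ENNReal.ofReal_pow (abs_nonneg _),
    ENNReal.ofReal_pow (norm_nonneg _), ← Real.enorm_eq_ofReal_abs, ofReal_norm]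
end

section
/- Let 𝔥 be a complex Hilbert space, let M ∈ ℕ with M ≥ 1, and let z₁, …, z_M ∈ 𝔥 be pairwise distinct. For each ε ∈ (0,1), let ζ₁(ε), …, ζ_M(ε) ∈ ℂ and, for each pair j < k, let w_{jk}(ε) ∈ ℂ with |w_{jk}(ε)| ≤ 1, and assume the normalization identity Σ_{j=1}^{M} |ζ_j(ε)|² + 2 Re Σ_{j<k} conj(ζ_j(ε)) ζ_k(ε) w_{jk}(ε) e^{−‖z_j − z_k‖²/(2ε)} = 1 holds. Then Σ_{j=1}^{M} (1 − C_j(ε)) |ζ_j(ε)|² ≤ 1 where 0 ≤ C_j(ε) ≤ 2M max_{j<k} e^{−‖z_j − z_k‖²/(2ε)}, and there exists ε₀ ∈ (0,1) such that for all ε ∈ (0, ε₀), Σ_{j=1}^{M} |ζ_j(ε)|² ≤ 2. -/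
open MeasureTheory

/-- The off-diagonal part of a Hermitian form whose entries are bounded by `S`, tested on a
vector with `n` entries, is at most `2 * n * S` times the squared `ℓ²` norm of that vector. -/
lemma neg_two_mul_re_sum_lt_le {n : ℕ} (a : Fin n → ℂ) (u : Fin n → Fin n → ℂ) {S : ℝ}
    (hS : 0 ≤ S) (hu : ∀ j k, j < k → ‖u j k‖ ≤ S) :
    -(2 * (∑ j, ∑ k, if j < k then (starRingEnd ℂ) (a j) * a k * u j k else 0).re) ≤
      2 * n * S * ∑ j, ‖a j‖ ^ 2 := by
  have hterm (j k : Fin n) :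
      -(2 * (if j < k then (starRingEnd ℂ) (a j) * a k * u j k else 0).re) ≤
        S * (‖a j‖ ^ 2 + ‖a k‖ ^ 2) := by
    split_ifs with h
    · have hre := (abs_le.mp (Complex.abs_re_le_norm ((starRingEnd ℂ) (a j) * a k * u j k))).1
      have hprod : ‖(starRingEnd ℂ) (a j) * a k * u j k‖ ≤ ‖a j‖ * ‖a k‖ * S := by
        rw [norm_mul, norm_mul, RCLike.norm_conj]
        gcongr
        exact hu j k h
      nlinarith [mul_nonneg hS (sq_nonneg (‖a j‖ - ‖a k‖))]
    · simp only [Complex.zero_re, mul_zero, neg_zero]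
      positivity
  calc -(2 * (∑ j, ∑ k, if j < k then (starRingEnd ℂ) (a j) * a k * u j k else 0).re)
      = ∑ j, ∑ k, -(2 * (if j < k then (starRingEnd ℂ) (a j) * a k * u j k else 0).re) := by
        simp only [Complex.re_sum, Finset.mul_sum, Finset.sum_neg_distrib]
    _ ≤ ∑ j, ∑ k, S * (‖a j‖ ^ 2 + ‖a k‖ ^ 2) :=
        Finset.sum_le_sum fun j _ => Finset.sum_le_sum fun k _ => hterm j k
    _ = 2 * n * S * ∑ j, ‖a j‖ ^ 2 := by
        simp only [← Finset.mul_sum, Finset.sum_add_distrib, Finset.sum_const, Finset.card_univ,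
          Fintype.card_fin, nsmul_eq_mul]
        ring

/-- A Gaussian weight `exp (-c / (2 * ε))` with `0 < c` tends to zero as `ε` decreases to zero. -/
lemma tendsto_exp_neg_div_two_mul_nhdsGT_zero {c : ℝ} (hc : 0 < c) :
    Filter.Tendsto (fun ε : ℝ => Real.exp (-c / (2 * ε))) (nhdsWithin 0 (Set.Ioi 0))
      (nhds 0) := by
  refine Real.tendsto_exp_atBot.comp ?_
  have h := tendsto_inv_nhdsGT_zero (𝕜 := ℝ).const_mul_atTop_of_neg
    (show -c / 2 < 0 by linarith)
  refine h.congr fun ε => ?_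
  rw [div_mul_eq_div_div, div_eq_mul_inv (-c / 2)]

/-- An entry of a real family indexed by ordered pairs is at most the supremum of the family. -/
lemma le_iSup_iSup_lt {n : ℕ} (f : Fin n → Fin n → ℝ) {j k : Fin n} (h : j < k) :
    f j k ≤ ⨆ j', ⨆ k', ⨆ (_ : j' < k'), f j' k' := by
  calc f j k = ⨆ (_ : j < k), f j k := (ciSup_pos (f := fun _ => f j k) h).symm
    _ ≤ ⨆ k', ⨆ (_ : j < k'), f j k' :=
        le_ciSup (f := fun k' => ⨆ (_ : j < k'), f j k') (Set.finite_range _).bddAbove k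
    _ ≤ ⨆ j', ⨆ k', ⨆ (_ : j' < k'), f j' k' :=
        le_ciSup (f := fun j' => ⨆ k', ⨆ (_ : j' < k'), f j' k') (Set.finite_range _).bddAbove j

/-- Coherent-state normalization identity: if the coefficients `ζ_j(ε)` of a combination
of squeezed coherent states with pairwise distinct arguments `z_j` satisfy the
normalization identity
`Σ_j |ζ_j(ε)|² + 2 Re Σ_{j<k} conj(ζ_j(ε)) ζ_k(ε) w_{jk}(ε) e^{−‖z_j−z_k‖²/(2ε)} = 1`
with `|w_{jk}(ε)| ≤ 1`, then `Σ_j (1 − C_j(ε)) |ζ_j(ε)|² ≤ 1` for suitable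
`0 ≤ C_j(ε) ≤ 2M max_{j<k} e^{−‖z_j−z_k‖²/(2ε)}`, and for all `ε` small enough
`Σ_j |ζ_j(ε)|² ≤ 2`. -/
theorem coherent_state_coefficients_bounded
    {𝓗 : Type*} [NormedAddCommGroup 𝓗] [InnerProductSpace ℂ 𝓗]
    (M : ℕ) (hM : 1 ≤ M) (z : Fin M → 𝓗) (hz : Function.Injective z)
    (ζ : ℝ → Fin M → ℂ) (w : ℝ → Fin M → Fin M → ℂ)
    (hw : ∀ ε : ℝ, 0 < ε → ε < 1 → ∀ j k : Fin M, j < k → ‖w ε j k‖ ≤ 1)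
    (hnorm : ∀ ε : ℝ, 0 < ε → ε < 1 →
      (∑ j, ‖ζ ε j‖ ^ 2)
          + 2 * (∑ j, ∑ k, if j < k then
              (starRingEnd ℂ) (ζ ε j) * ζ ε k * w ε j k
                * (Real.exp (-‖z j - z k‖ ^ 2 / (2 * ε)) : ℂ)
            else 0).re = 1) :
    (∀ ε : ℝ, 0 < ε → ε < 1 → ∃ C : Fin M → ℝ,
        (∀ j, 0 ≤ C j ∧ C j ≤ 2 * M * ⨆ j', ⨆ k', ⨆ (_ : j' < k'),
            Real.exp (-‖z j' - z k'‖ ^ 2 / (2 * ε))) ∧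
          ∑ j, (1 - C j) * ‖ζ ε j‖ ^ 2 ≤ 1) ∧
      ∃ ε₀ : ℝ, 0 < ε₀ ∧ ε₀ < 1 ∧
        ∀ ε : ℝ, 0 < ε → ε < ε₀ → ∑ j, ‖ζ ε j‖ ^ 2 ≤ 2 := by
  have hbound (ε : ℝ) (h0 : 0 < ε) (h1 : ε < 1) (S : ℝ) (hS : 0 ≤ S)
      (hexp : ∀ j k, j < k → Real.exp (-‖z j - z k‖ ^ 2 / (2 * ε)) ≤ S) :
      (1 - 2 * M * S) * ∑ j, ‖ζ ε j‖ ^ 2 ≤ 1 := by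
    have hu (j k : Fin M) (hjk : j < k) :
        ‖w ε j k * (Real.exp (-‖z j - z k‖ ^ 2 / (2 * ε)) : ℂ)‖ ≤ S := by
      rw [norm_mul, Complex.norm_real, Real.norm_of_nonneg (Real.exp_nonneg _)]
      exact (mul_le_of_le_one_left (Real.exp_nonneg _) (hw ε h0 h1 j k hjk)).trans
        (hexp j k hjk)
    have h := neg_two_mul_re_sum_lt_le (ζ ε) _ hS hu
    have hn := hnorm ε h0 h1
    simp only [← mul_assoc] at h hn
    linarith
  refine ⟨fun ε h0 h1 => ?_, ?_⟩
  · set S : ℝ := ⨆ j', ⨆ k', ⨆ (_ : j' < k'), Real.exp (-‖z j' - z k'‖ ^ 2 / (2 * ε))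
    have hS : 0 ≤ S := Real.iSup_nonneg fun _ => Real.iSup_nonneg fun _ =>
      Real.iSup_nonneg fun _ => Real.exp_nonneg _
    refine ⟨fun _ => 2 * M * S, fun _ => ⟨by positivity, le_rfl⟩, ?_⟩
    rw [← Finset.mul_sum]
    exact hbound ε h0 h1 S hS fun j k hjk =>
      le_iSup_iSup_lt (fun j k => Real.exp (-‖z j - z k‖ ^ 2 / (2 * ε))) hjk
  · have hMpos : (0 : ℝ) < M := by exact_mod_cast hM
    have hev : ∀ᶠ ε : ℝ in nhdsWithin 0 (Set.Ioi 0), ∀ j k : Fin M, j < k →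
        Real.exp (-‖z j - z k‖ ^ 2 / (2 * ε)) ≤ 1 / (4 * M) := by
      simp only [Filter.eventually_all]
      intro j k hjk
      have hd : 0 < ‖z j - z k‖ ^ 2 :=
        pow_pos (norm_pos_iff.mpr (sub_ne_zero.mpr (hz.ne hjk.ne))) 2
      exact (tendsto_exp_neg_div_two_mul_nhdsGT_zero hd).eventually_le_const (by positivity)
    obtain ⟨δ, hδ, hsub⟩ := mem_nhdsGT_iff_exists_Ioo_subset.mp hev
    refine ⟨min δ (1 / 2), lt_min hδ (by norm_num), (min_le_right _ _).trans_lt (by norm_num),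
      fun ε h0 h1 => ?_⟩
    have h := hbound ε h0 (by linarith [min_le_right δ (1 / 2)]) (1 / (4 * M)) (by positivity)
      (hsub ⟨h0, h1.trans_le (min_le_left _ _)⟩)
    have hhalf : 1 - 2 * (M : ℝ) * (1 / (4 * M)) = 1 / 2 := by
      field_simp
      norm_num
    rw [hhalf] at h
    linarith
end
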